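/- Let α ∈ ℝ and let ν be an m^α-invariant measure of the subcritical BGW process killed at 0. Set M = m^{−1}. Then for every β < α there exists a constant C < ∞ such that ∑_{k ∈ ℕ*, Mⁿ ≤ k < M^{n+1}} ν(k) ≤ C·m^{β·n} for all n ∈ ℕ. -/

import Mathlib

open MeasureTheory Real Set

/-- `convPow q i j` is the `i`-fold convolution power of the offspring distribution `q`
evaluated at `j`, i.e. the transition matrix `P₀(i,j)` of the BGW process. -/
noncomputable def convPow (q : ℕ → ℝ) : ℕ → ℕ → ℝ
  | 0, j => if j = 0 then 1 else 0
  | i + 1, j => ∑ k ∈ Finset.range (j + 1), convPow q i (j - k) * q k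

/-- `ν` is a `lam`-invariant measure on `ℕ* = {1,2,…}` of the BGW process killed at 0. -/
def IsInvMeasure (q : ℕ → ℝ) (lam : ℝ) (ν : ℕ → ℝ) : Prop :=
  (∀ n, 0 ≤ ν n) ∧ ν 0 = 0 ∧
  ∀ j : ℕ, 1 ≤ j →
    Summable (fun i => ν i * convPow q i j) ∧
    ∑' i, ν i * convPow q i j = lam * ν j

lemma hasSum_of_eq_fun {f g : ℕ → ℝ} {a : ℝ} (h : HasSum g a) (e : ∀ j, f j = g j) :
    HasSum f a := by
  rw [funext e]; exact h

lemma convPow_nonneg (q : ℕ → ℝ) (hq0 : ∀ k, 0 ≤ q k) (i j : ℕ) : 0 ≤ convPow q i j := by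
  induction i generalizing j with
  | zero => simp only [convPow]; split_ifs <;> norm_num
  | succ i ih =>
    simp only [convPow]
    exact Finset.sum_nonneg fun k _ => mul_nonneg (ih _) (hq0 _)

lemma summable_gf (q : ℕ → ℝ) (hq0 : ∀ k, 0 ≤ q k) (hq1 : HasSum q 1)
    (s : ℝ) (hs0 : 0 ≤ s) (hs1 : s ≤ 1) : Summable (fun k => q k * s ^ k) :=
  Summable.of_nonneg_of_le (fun k => mul_nonneg (hq0 k) (pow_nonneg hs0 k))
    (fun k => mul_le_of_le_one_right (hq0 k) (pow_le_one₀ hs0 hs1)) hq1.summable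

lemma hasSum_gf (q : ℕ → ℝ) (hq0 : ∀ k, 0 ≤ q k) (hq1 : HasSum q 1)
    (s : ℝ) (hs0 : 0 ≤ s) (hs1 : s ≤ 1) (i : ℕ) :
    HasSum (fun j => convPow q i j * s ^ j) ((∑' k, q k * s ^ k) ^ i) := by
  induction i with
  | zero =>
    have := hasSum_ite_eq (0 : ℕ) (1 : ℝ)
    simp only [pow_zero]
    convert this using 1
    funext j
    by_cases h : j = 0 <;> simp [convPow, h]
  | succ i ih =>
    have hn1 : Summable (fun j => ‖convPow q i j * s ^ j‖) := ih.summable.norm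
    have hn2 : Summable (fun k => ‖q k * s ^ k‖) := (summable_gf q hq0 hq1 s hs0 hs1).norm
    have h1 := tsum_mul_tsum_eq_tsum_sum_range_of_summable_norm hn2 hn1
    have h2 := (summable_norm_sum_mul_range_of_summable_norm hn2 hn1).of_norm
    have h3 := h2.hasSum
    rw [← h1, ih.tsum_eq] at h3
    rw [pow_succ, mul_comm]
    refine hasSum_of_eq_fun h3 fun j => ?_
    simp only [convPow, Finset.sum_mul]
    refine Finset.sum_congr rfl fun k hk => ?_
    have hk' : k ≤ j := by simpa [Nat.lt_succ_iff] using hk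
    have : s ^ j = s ^ k * s ^ (j - k) := by rw [← pow_add]; congr 1; omega
    rw [this]; ring

open Filter Topology in
lemma laplace_limit (q : ℕ → ℝ) (hq0 : ∀ k, 0 ≤ q k) (hq1 : HasSum q 1)
    (m : ℝ) (hm : HasSum (fun k : ℕ => (k : ℝ) * q k) m) (t : ℝ) (ht : 0 ≤ t) :
    Tendsto (fun i : ℕ => (∑' k, q k * (Real.exp (-t / i)) ^ k) ^ i) atTop
      (𝓝 (Real.exp (-t * m))) := by
  have key : Tendsto (fun i : ℕ => (i : ℝ) * (∑' k, q k * (Real.exp (-t / i)) ^ k - 1)) atTop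
      (𝓝 (-t * m)) := by
    have h1 : ∀ i : ℕ, (i : ℝ) * (∑' k, q k * (Real.exp (-t / i)) ^ k - 1) =
        ∑' k, q k * ((i : ℝ) * ((Real.exp (-t / i)) ^ k - 1)) := by
      intro i
      have hs1 : Real.exp (-t / i) ≤ 1 := by
        rw [Real.exp_le_one_iff]
        exact div_nonpos_of_nonpos_of_nonneg (by linarith) (Nat.cast_nonneg i)
      have := ((summable_gf q hq0 hq1 _ (Real.exp_pos (-t / i)).le hs1).hasSum.sub hq1).mul_left
        (i : ℝ)
      rw [← this.tsum_eq]
      congr 1; funext k; ring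
    simp_rw [h1]
    have h2 : -t * m = ∑' k, q k * (-t * k) := by
      rw [← (hm.mul_left (-t)).tsum_eq]; congr 1; funext k; ring
    rw [h2]
    refine tendsto_tsum_of_dominated_convergence (bound := fun k => t * (k * q k))
      (hm.summable.mul_left t) ?_ ?_
    · intro k
      refine Tendsto.const_mul _ ?_
      have hd : HasDerivAt (fun y : ℝ => Real.exp ((-t * k) * y)) (-t * k) 0 := by
        have := ((hasDerivAt_id (0 : ℝ)).const_mul (-t * k)).exp
        simpa using this
      have h3 := hd.tendsto_slope_zero
      have h4 : Tendsto (fun i : ℕ => ((i : ℝ))⁻¹) atTop (𝓝[≠] 0) := by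
        refine tendsto_nhdsWithin_iff.2 ⟨tendsto_inv_atTop_nhds_zero_nat, ?_⟩
        filter_upwards [eventually_gt_atTop 0] with i hi
        simp; omega
      have h5 := h3.comp h4
      refine h5.congr fun i => ?_
      simp only [Function.comp, inv_inv, zero_add, mul_zero, Real.exp_zero, smul_eq_mul]
      rw [← Real.exp_nat_mul]
      congr 3; ring
    · filter_upwards [eventually_gt_atTop 0] with i hi k
      have hi' : (0 : ℝ) < i := by exact_mod_cast hi
      rw [← Real.exp_nat_mul, norm_mul, norm_mul, Real.norm_of_nonneg (hq0 k),
        Real.norm_of_nonneg hi'.le]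
      have h6 : (k : ℝ) * (-t / i) ≤ 0 :=
        mul_nonpos_of_nonneg_of_nonpos (Nat.cast_nonneg k)
          (div_nonpos_of_nonpos_of_nonneg (by linarith) hi'.le)
      have h7 : Real.exp (k * (-t / i)) ≤ 1 := Real.exp_le_one_iff.2 h6
      have h8 := Real.add_one_le_exp ((k : ℝ) * (-t / i))
      rw [Real.norm_of_nonpos (by linarith)]
      have h9 : (i : ℝ) * -(Real.exp (k * (-t / i)) - 1) ≤ t * k := by
        calc (i : ℝ) * -(Real.exp (k * (-t / i)) - 1) ≤ i * -((k : ℝ) * (-t / i)) := by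
              gcongr; linarith
          _ = t * k := by field_simp
      calc _ ≤ q k * (t * k) := mul_le_mul_of_nonneg_left h9 (hq0 k)
        _ = _ := by ring
  have := Real.tendsto_one_add_pow_exp_of_tendsto key
  refine this.congr fun i => ?_
  congr 1; ring

/-- The mass of `ν` on `[a,b)`. -/
noncomputable def massOn (ν : ℕ → ℝ) (a b : ℝ) : ℝ :=
  ∑ k ∈ (Finset.range ⌈b⌉₊).filter (fun k : ℕ => a ≤ (k : ℝ)), ν k

lemma mem_block (a b : ℝ) (k : ℕ) :
    k ∈ (Finset.range ⌈b⌉₊).filter (fun k : ℕ => a ≤ (k : ℝ)) ↔ a ≤ k ∧ (k : ℝ) < b := by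
  rw [Finset.mem_filter, Finset.mem_range, Nat.lt_ceil, and_comm]

open Filter Topology in
lemma wlln (q : ℕ → ℝ) (hq0 : ∀ k, 0 ≤ q k) (hq1 : HasSum q 1)
    (m : ℝ) (hm : HasSum (fun k : ℕ => (k : ℝ) * q k) m) (lo hi c : ℝ)
    (hlo : lo < m) (hhi : m < hi) (hc : c < 1) :
    ∃ K : ℕ, ∀ i : ℕ, K ≤ i → c ≤ massOn (convPow q i) (lo * i) (hi * i) := by
  set F : ℝ → ℕ → ℝ := fun t i => (∑' k, q k * (Real.exp (-t / i)) ^ k) ^ i with hF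
  have hFs : ∀ t, 0 ≤ t → ∀ i, HasSum (fun j => convPow q i j * (Real.exp (-t / i)) ^ j) (F t i) := by
    intro t ht i
    refine hasSum_gf q hq0 hq1 _ (Real.exp_pos _).le ?_ i
    rw [Real.exp_le_one_iff]
    exact div_nonpos_of_nonpos_of_nonneg (by linarith) (Nat.cast_nonneg i)
  have hone : ∀ i, HasSum (fun j => convPow q i j) 1 := by
    intro i
    have := hasSum_gf q hq0 hq1 1 zero_le_one le_rfl i
    simpa [hq1.tsum_eq] using this
  set V : ℕ → ℝ := fun i => F 2 i - 2 * Real.exp (-m) * F 1 i + Real.exp (-m) ^ 2 with hV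
  have hVs : ∀ i, HasSum (fun j : ℕ => convPow q i j * (Real.exp (-(j / i : ℝ)) - Real.exp (-m)) ^ 2)
      (V i) := by
    intro i
    have h := ((hFs 2 (by norm_num) i).sub
      ((hFs 1 (by norm_num) i).mul_left (2 * Real.exp (-m)))).add
      ((hone i).mul_left (Real.exp (-m) ^ 2))
    rw [mul_one] at h
    refine hasSum_of_eq_fun h fun j => ?_
    rw [← Real.exp_nat_mul, ← Real.exp_nat_mul]
    have e1 : Real.exp ((j : ℝ) * (-2 / i)) = Real.exp (-(j / i : ℝ)) ^ 2 := by
      rw [← Real.exp_nat_mul]; congr 1; push_cast; ring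
    have e2 : (j : ℝ) * (-1 / i) = -(j / i : ℝ) := by ring
    rw [e1, e2]; ring
  have hVlim : Tendsto V atTop (𝓝 0) := by
    have h2 := laplace_limit q hq0 hq1 m hm 2 (by norm_num)
    have h1 := laplace_limit q hq0 hq1 m hm 1 (by norm_num)
    have h := (h2.sub (h1.const_mul (2 * Real.exp (-m)))).add_const (Real.exp (-m) ^ 2)
    convert h using 1
    have e1 : Real.exp (-2 * m) = Real.exp (-m) ^ 2 := by
      rw [← Real.exp_nat_mul]; congr 1; push_cast; ring
    have e2 : -1 * m = -m := by ring
    rw [e1, e2]; congr 1; ring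
  set d1 := Real.exp (-lo) - Real.exp (-m) with hd1
  set d2 := Real.exp (-m) - Real.exp (-hi) with hd2
  have hd1p : 0 < d1 := sub_pos.2 (Real.exp_lt_exp.2 (by linarith))
  have hd2p : 0 < d2 := sub_pos.2 (Real.exp_lt_exp.2 (by linarith))
  set η := min d1 d2 with hη
  have hηp : 0 < η := lt_min hd1p hd2p
  have hev : ∀ᶠ i in atTop, V i < (1 - c) * η ^ 2 :=
    hVlim.eventually_lt_const (mul_pos (by linarith) (by positivity))
  obtain ⟨K, hK⟩ := eventually_atTop.1 (hev.and (eventually_gt_atTop 0))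
  refine ⟨K, fun i hi' => ?_⟩
  obtain ⟨hVi, hipos⟩ := hK i hi'
  have hiR : (0 : ℝ) < i := by exact_mod_cast hipos
  set J := (Finset.range ⌈hi * i⌉₊).filter (fun k : ℕ => lo * i ≤ (k : ℝ)) with hJ
  have hJs : HasSum (fun j => if j ∈ J then convPow q i j else 0)
      (massOn (convPow q i) (lo * i) (hi * i)) := by
    have := hasSum_sum_of_ne_finset_zero (f := fun j => if j ∈ J then convPow q i j else 0)
      (s := J) (L := SummationFilter.unconditional ℕ) (fun b hb => if_neg hb)
    convert this using 1
    unfold massOn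
    exact Finset.sum_congr rfl fun j hj => (if_pos hj).symm
  have hcomp := hasSum_le (fun j => ?_) (((hone i).sub hJs).mul_left (η ^ 2)) (hVs i)
  · have hη2 : 0 < η ^ 2 := by positivity
    have : η ^ 2 * (1 - massOn (convPow q i) (lo * i) (hi * i)) < η ^ 2 * (1 - c) := by
      linarith
    have := lt_of_mul_lt_mul_left this hη2.le
    linarith
  · have hp := convPow_nonneg q hq0 i j
    by_cases hj : j ∈ J
    · simp only [hj, if_true, sub_self, mul_zero]; positivity
    · simp only [hj, if_false, sub_zero]
      rw [mul_comm]
      refine mul_le_mul_of_nonneg_left ?_ hp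
      rw [hJ, mem_block] at hj
      rw [sq_le_sq, abs_of_pos hηp]
      by_cases hl : lo * i ≤ j
      · have h2 : hi * i ≤ j := by
          by_contra hcon
          exact hj ⟨hl, not_le.1 hcon⟩
        have h3 : hi ≤ j / i := (le_div_iff₀ hiR).2 h2
        have h4 : Real.exp (-(j / i : ℝ)) ≤ Real.exp (-hi) := Real.exp_le_exp.2 (by linarith)
        rw [abs_sub_comm]
        refine le_trans ?_ (le_abs_self _)
        have := min_le_right d1 d2
        linarith
      · have h3 : (j : ℝ) / i ≤ lo := (div_le_iff₀ hiR).2 (not_le.1 hl).le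
        have h4 : Real.exp (-lo) ≤ Real.exp (-(j / i : ℝ)) := Real.exp_le_exp.2 (by linarith)
        refine le_trans ?_ (le_abs_self _)
        have := min_le_left d1 d2
        linarith

lemma massOn_mono (ν : ℕ → ℝ) (h0 : ∀ n, 0 ≤ ν n) {a b a' b' : ℝ} (ha : a' ≤ a) (hb : b ≤ b') :
    massOn ν a b ≤ massOn ν a' b' := by
  unfold massOn
  refine Finset.sum_le_sum_of_subset_of_nonneg (fun k hk => ?_) (fun k _ _ => h0 k)
  rw [mem_block] at hk ⊢
  exact ⟨ha.trans hk.1, hk.2.trans_le hb⟩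

lemma massOn_split (ν : ℕ → ℝ) (h0 : ∀ n, 0 ≤ ν n) (a b c : ℝ) :
    massOn ν a c ≤ massOn ν a b + massOn ν b c := by
  unfold massOn
  rw [← Finset.sum_union_inter]
  refine le_trans ?_ (le_add_of_nonneg_right (Finset.sum_nonneg fun k _ => h0 k))
  refine Finset.sum_le_sum_of_subset_of_nonneg (fun k hk => ?_) (fun k _ _ => h0 k)
  rw [Finset.mem_union]
  rw [mem_block] at hk ⊢
  rw [mem_block]
  rcases lt_or_ge (k : ℝ) b with h | h
  · exact Or.inl ⟨hk.1, h⟩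
  · exact Or.inr ⟨h, hk.2⟩

lemma massOn_nonneg (ν : ℕ → ℝ) (h0 : ∀ n, 0 ≤ ν n) (a b : ℝ) : 0 ≤ massOn ν a b :=
  Finset.sum_nonneg fun k _ => h0 k

lemma one_step (q : ℕ → ℝ) (hq0 : ∀ k, 0 ≤ q k) (lam : ℝ) (ν : ℕ → ℝ)
    (hν : IsInvMeasure q lam ν) (lo hi c : ℝ) (hlo : 0 < lo) (hhi : 0 < hi) (K : ℕ)
    (hK : ∀ i : ℕ, K ≤ i → c ≤ massOn (convPow q i) (lo * i) (hi * i))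
    (a b : ℝ) (ha : 0 < a) (haK : (K : ℝ) ≤ a) :
    c * massOn ν a b ≤ lam * massOn ν (lo * a) (hi * b) := by
  obtain ⟨h0, -, hinv⟩ := hν
  have hp := convPow_nonneg q hq0
  conv_rhs => unfold massOn
  rw [Finset.mul_sum]
  calc c * massOn ν a b
      ≤ ∑ i ∈ (Finset.range ⌈b⌉₊).filter (fun k : ℕ => a ≤ (k : ℝ)),
          ν i * massOn (convPow q i) (lo * a) (hi * b) := by
        unfold massOn
        rw [Finset.mul_sum]
        refine Finset.sum_le_sum fun i hi' => ?_
        rw [mem_block] at hi'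
        rw [mul_comm]
        refine mul_le_mul_of_nonneg_left ?_ (h0 i)
        refine (hK i (by exact_mod_cast haK.trans hi'.1)).trans ?_
        refine massOn_mono _ (hp i) ?_ ?_
        · exact mul_le_mul_of_nonneg_left hi'.1 hlo.le
        · exact mul_le_mul_of_nonneg_left hi'.2.le hhi.le
    _ = ∑ j ∈ (Finset.range ⌈hi * b⌉₊).filter (fun k : ℕ => lo * a ≤ (k : ℝ)),
          ∑ i ∈ (Finset.range ⌈b⌉₊).filter (fun k : ℕ => a ≤ (k : ℝ)), ν i * convPow q i j := by
        unfold massOn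
        rw [Finset.sum_comm]
        exact Finset.sum_congr rfl fun i _ => Finset.mul_sum _ _ _
    _ ≤ _ := by
        refine Finset.sum_le_sum fun j hj => ?_
        rw [mem_block] at hj
        have hj1 : 1 ≤ j := by
          have : (0 : ℝ) < j := lt_of_lt_of_le (mul_pos hlo ha) hj.1
          exact_mod_cast this
        obtain ⟨hs, he⟩ := hinv j hj1
        rw [← he]
        exact hs.sum_le_tsum _ (fun i _ => mul_nonneg (h0 i) (hp i j))

lemma multi_step (q : ℕ → ℝ) (hq0 : ∀ k, 0 ≤ q k) (lam : ℝ) (hlam : 0 ≤ lam) (ν : ℕ → ℝ)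
    (hν : IsInvMeasure q lam ν) (lo hi c : ℝ) (hlo : 0 < lo) (hlo1 : lo ≤ 1) (hhi : 0 < hi)
    (hc : 0 < c) (K : ℕ)
    (hK : ∀ i : ℕ, K ≤ i → c ≤ massOn (convPow q i) (lo * i) (hi * i))
    (a b : ℝ) (ha : 0 < a) (L : ℕ) (haK : (K : ℝ) ≤ lo ^ L * a) :
    massOn ν a b ≤ (lam / c) ^ L * massOn ν (lo ^ L * a) (hi ^ L * b) := by
  induction L with
  | zero => simp
  | succ L ih =>
    have h1 : lo ^ (L + 1) * a ≤ lo ^ L * a :=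
      mul_le_mul_of_nonneg_right (pow_le_pow_of_le_one hlo.le hlo1 (Nat.le_succ L)) ha.le
    have h2 := ih (haK.trans h1)
    refine h2.trans ?_
    have h3 := one_step q hq0 lam ν hν lo hi c hlo hhi K hK (lo ^ L * a) (hi ^ L * b)
      (by positivity) (haK.trans h1)
    rw [pow_succ (lam / c), mul_assoc]
    refine mul_le_mul_of_nonneg_left ?_ (by positivity)
    rw [div_mul_eq_mul_div, le_div_iff₀ hc, mul_comm]
    rw [pow_succ', pow_succ', mul_assoc, mul_assoc]
    exact h3

lemma tsum_eq_massOn (ν : ℕ → ℝ) (a b : ℝ) :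
    (∑' k : ℕ, if a ≤ (k : ℝ) ∧ (k : ℝ) < b then ν k else 0) = massOn ν a b := by
  rw [tsum_eq_sum (s := (Finset.range ⌈b⌉₊).filter (fun k : ℕ => a ≤ (k : ℝ)))]
  · unfold massOn
    refine Finset.sum_congr rfl fun k hk => ?_
    rw [mem_block] at hk
    exact if_pos hk
  · intro k hk
    rw [mem_block] at hk
    exact if_neg hk

theorem invariant_measure_dyadic_tail_bound
    (q : ℕ → ℝ) (hq0 : ∀ k, 0 ≤ q k) (hq1 : HasSum q 1)
    (m : ℝ) (hm : HasSum (fun k : ℕ => (k : ℝ) * q k) m) (hm0 : 0 < m) (hm1 : m < 1)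
    (α : ℝ) (ν : ℕ → ℝ) (hν : IsInvMeasure q (m ^ α) ν) :
    ∀ β : ℝ, β < α → ∃ C : ℝ, ∀ n : ℕ,
      (∑' k : ℕ, if (m⁻¹) ^ n ≤ (k : ℝ) ∧ (k : ℝ) < (m⁻¹) ^ (n + 1) then ν k else 0)
        ≤ C * m ^ (β * (n : ℝ)) := by
  intro β hβ
  simp_rw [tsum_eq_massOn]
  have h0 := hν.1
  set γ : ℝ := (α + β) / 2 with hγ
  set c : ℝ := m ^ (α - γ) with hc
  have hcpos : 0 < c := Real.rpow_pos_of_pos hm0 _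
  have hc1 : c < 1 := Real.rpow_lt_one hm0.le hm1 (by rw [hγ]; linarith)
  have hlamc : m ^ α / c = m ^ γ := by
    rw [hc, ← Real.rpow_sub hm0]; congr 1; ring
  set S : ℝ := m ^ (-β) + 1 + m ^ β with hS
  have hSpos : 0 < S := by positivity
  -- choose L
  have hr0 : 0 < m ^ (γ - β) := Real.rpow_pos_of_pos hm0 _
  have hr1 : m ^ (γ - β) < 1 := Real.rpow_lt_one hm0.le hm1 (by rw [hγ]; linarith)
  obtain ⟨L, hL2, hL⟩ : ∃ L : ℕ, 2 ≤ L ∧ (m ^ (γ - β)) ^ L * S ≤ 1 := by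
    obtain ⟨l, hl⟩ := exists_pow_lt_of_lt_one (inv_pos.2 hSpos) hr1
    refine ⟨l + 2, by omega, ?_⟩
    have : (m ^ (γ - β)) ^ (l + 2) ≤ (m ^ (γ - β)) ^ l :=
      pow_le_pow_of_le_one hr0.le hr1.le (by omega)
    calc (m ^ (γ - β)) ^ (l + 2) * S ≤ S⁻¹ * S :=
          mul_le_mul_of_nonneg_right (this.trans hl.le) hSpos.le
      _ = 1 := inv_mul_cancel₀ hSpos.ne'
  have hLR : (0 : ℝ) < L := by exact_mod_cast (by omega : 0 < L)
  set lo : ℝ := m ^ (1 + 1 / (L : ℝ)) with hlo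
  set hi : ℝ := m ^ (1 - 1 / (L : ℝ)) with hhi
  have hlopos : 0 < lo := Real.rpow_pos_of_pos hm0 _
  have hhipos : 0 < hi := Real.rpow_pos_of_pos hm0 _
  have hiL : 0 < 1 / (L : ℝ) := by positivity
  have hlom : lo < m := by
    have := Real.rpow_lt_rpow_of_exponent_gt hm0 hm1 (show (1 : ℝ) < 1 + 1 / L by linarith)
    rwa [Real.rpow_one] at this
  have hmhi : m < hi := by
    have := Real.rpow_lt_rpow_of_exponent_gt hm0 hm1 (show 1 - 1 / (L : ℝ) < 1 by linarith)
    rwa [Real.rpow_one] at this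
  have hloL : lo ^ L = m ^ (L + 1) := by
    rw [hlo, ← Real.rpow_natCast, ← Real.rpow_mul hm0.le, ← Real.rpow_natCast]
    congr 1; push_cast; field_simp
  have hhiL : hi ^ L = m ^ (L - 1) := by
    rw [hhi, ← Real.rpow_natCast, ← Real.rpow_mul hm0.le, ← Real.rpow_natCast]
    congr 1; rw [Nat.cast_sub (by omega)]; push_cast; field_simp
  obtain ⟨K, hK⟩ := wlln q hq0 hq1 m hm lo hi c hlom hmhi hc1
  have hM1 : 1 < m⁻¹ := (one_lt_inv₀ hm0).2 hm1
  obtain ⟨p, hp⟩ := pow_unbounded_of_one_lt (K : ℝ) hM1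
  set A : ℕ → ℝ := fun n => massOn ν (m⁻¹ ^ n) (m⁻¹ ^ (n + 1)) with hA
  have hA0 : ∀ n, 0 ≤ A n := fun n => massOn_nonneg ν h0 _ _
  have hrec : ∀ r, p ≤ r →
      A (r + L + 1) ≤ (m ^ γ) ^ L * (A r + A (r + 1) + A (r + 2)) := by
    intro r hr
    have ea : lo ^ L * m⁻¹ ^ (r + L + 1) = m⁻¹ ^ r := by
      rw [hloL, add_assoc, pow_add _ r, inv_pow m (L + 1)]
      field_simp
    have eb : hi ^ L * m⁻¹ ^ (r + L + 1 + 1) = m⁻¹ ^ (r + 3) := by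
      rw [hhiL, show r + L + 1 + 1 = (r + 3) + (L - 1) by omega, pow_add _ (r + 3),
        inv_pow m (L - 1)]
      field_simp
    have h := multi_step q hq0 (m ^ α) (by positivity) ν hν lo hi c hlopos (by linarith) hhipos
      hcpos K hK (m⁻¹ ^ (r + L + 1)) (m⁻¹ ^ (r + L + 1 + 1)) (by positivity) L
      (by rw [ea]; exact hp.le.trans (pow_le_pow_right₀ hM1.le hr))
    rw [ea, eb, hlamc] at h
    refine h.trans (mul_le_mul_of_nonneg_left ?_ (by positivity))
    have s1 := massOn_split ν h0 (m⁻¹ ^ r) (m⁻¹ ^ (r + 1)) (m⁻¹ ^ (r + 3))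
    have s2 := massOn_split ν h0 (m⁻¹ ^ (r + 1)) (m⁻¹ ^ (r + 2)) (m⁻¹ ^ (r + 3))
    simp only [hA]
    linarith
  have hmp : ∀ x : ℝ, 0 < m ^ x := fun x => Real.rpow_pos_of_pos hm0 x
  set C : ℝ := ∑ k ∈ Finset.range (p + L + 1), A k / m ^ (β * (k : ℝ)) with hC
  have hC0 : 0 ≤ C := Finset.sum_nonneg fun k _ => div_nonneg (hA0 k) (hmp _).le
  refine ⟨C, fun n => ?_⟩
  change A n ≤ _
  induction n using Nat.strong_induction_on with
  | _ n ih =>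
    by_cases hn : n < p + L + 1
    · rw [← div_le_iff₀ (hmp _)]
      exact Finset.single_le_sum (f := fun k : ℕ => A k / m ^ (β * (k : ℝ)))
        (fun k _ => div_nonneg (hA0 k) (hmp _).le) (Finset.mem_range.2 hn)
    · obtain ⟨r, rfl⟩ : ∃ r, n = r + L + 1 := ⟨n - (L + 1), by omega⟩
      have i0 := ih r (by omega)
      have i1 := ih (r + 1) (by omega)
      have i2 := ih (r + 2) (by omega)
      refine (hrec r (by omega)).trans ?_
      have hg : (m ^ γ) ^ L = (m ^ (γ - β)) ^ L * m ^ (β * L) := by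
        rw [Real.rpow_mul hm0.le, Real.rpow_natCast, ← mul_pow, ← Real.rpow_add hm0]
        congr 2; ring
      have e0 : m ^ (β * L) * m ^ (β * (r : ℝ)) = m ^ (β * ((r + L + 1 : ℕ) : ℝ)) * m ^ (-β) := by
        rw [← Real.rpow_add hm0, ← Real.rpow_add hm0]; congr 1; push_cast; ring
      have e1 : m ^ (β * L) * m ^ (β * ((r + 1 : ℕ) : ℝ)) = m ^ (β * ((r + L + 1 : ℕ) : ℝ)) := by
        rw [← Real.rpow_add hm0]; congr 1; push_cast; ring
      have e2 : m ^ (β * L) * m ^ (β * ((r + 2 : ℕ) : ℝ)) =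
          m ^ (β * ((r + L + 1 : ℕ) : ℝ)) * m ^ β := by
        rw [← Real.rpow_add hm0, ← Real.rpow_add hm0]; congr 1; push_cast; ring
      calc (m ^ γ) ^ L * (A r + A (r + 1) + A (r + 2))
          ≤ (m ^ γ) ^ L * (C * m ^ (β * (r : ℝ)) + C * m ^ (β * ((r + 1 : ℕ) : ℝ))
              + C * m ^ (β * ((r + 2 : ℕ) : ℝ))) :=
            mul_le_mul_of_nonneg_left (by linarith) (by positivity)
        _ = (m ^ (γ - β)) ^ L * C * (m ^ (β * L) * m ^ (β * (r : ℝ))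
              + m ^ (β * L) * m ^ (β * ((r + 1 : ℕ) : ℝ))
              + m ^ (β * L) * m ^ (β * ((r + 2 : ℕ) : ℝ))) := by rw [hg]; ring
        _ = ((m ^ (γ - β)) ^ L * S) * (C * m ^ (β * ((r + L + 1 : ℕ) : ℝ))) := by
            rw [e0, e1, e2, hS]; ring
        _ ≤ 1 * (C * m ^ (β * ((r + L + 1 : ℕ) : ℝ))) :=
            mul_le_mul_of_nonneg_right hL (mul_nonneg hC0 (hmp _).le)
        _ = _ := one_mul _
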